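/- The topmost context is the only reduction context for embedded RHO combinator terms: if M is a RHO combinator containing no occurrence of C, and ((| C) M) reduces in one step (modulo structural congruence) to a term T, then T is structurally congruent to ((| C) M') for some combinator M' containing no occurrence of C. -/

import Mathlib

/-- Processes of the RHO calculus.  Every name of the RHO calculus is a quotation
`&P` of a process `P`; we represent the name `&P` by the process `P` itself.
`input y x P` is the input-guarded process `for(y ← x)P` (binding the name `y` in `P`),
`output x P` is `x!P`, `par P Q` is `P | Q`, and `deref x` is `*x`. -/
inductive Proc : Type
  | zero : Proc
  | input : Proc → Proc → Proc → Proc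
  | output : Proc → Proc → Proc
  | par : Proc → Proc → Proc
  | deref : Proc → Proc
deriving DecidableEq

/-- Names are quotations of processes; the name `&P` is represented by `P`. -/
abbrev Name := Proc

namespace Proc

/-- The free names of a process. -/
def FN : Proc → Finset Name
  | zero => ∅
  | input y x P => {x} ∪ (FN P \ {y})
  | output x P => {x} ∪ FN P
  | par P Q => FN P ∪ FN Q
  | deref x => {x}

/-- All names occurring in a process (free or bound). -/
def namesOf : Proc → Finset Name
  | zero => ∅
  | input y x P => {y, x} ∪ namesOf P
  | output x P => {x} ∪ namesOf P
  | par P Q => namesOf P ∪ namesOf Q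
  | deref x => {x}

/-- Transposition of two names. -/
def swapN (a b x : Name) : Name := if x = a then b else if x = b then a else x

/-- Transposition of two names applied throughout a process. -/
def swap (a b : Proc) : Proc → Proc
  | zero => zero
  | input y x P => input (swapN a b y) (swapN a b x) (swap a b P)
  | output x P => output (swapN a b x) (swap a b P)
  | par P Q => par (swap a b P) (swap a b Q)
  | deref x => deref (swapN a b x)

/-- α-equivalence: the congruence generated by renaming the bound name of an
input prefix to a fresh name. -/
inductive Alpha : Proc → Proc → Prop
  | rename (y z x : Name) (P : Proc) :
      z ∉ namesOf P → z ≠ x → z ≠ y →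
      Alpha (input y x P) (input z x (swap y z P))
  | refl (P : Proc) : Alpha P P
  | symm {P Q : Proc} : Alpha P Q → Alpha Q P
  | trans {P Q R : Proc} : Alpha P Q → Alpha Q R → Alpha P R
  | input {P P' : Proc} (y x : Name) : Alpha P P' → Alpha (input y x P) (input y x P')
  | output {P P' : Proc} (x : Name) : Alpha P P' → Alpha (output x P) (output x P')
  | par {P P' Q Q' : Proc} : Alpha P P' → Alpha Q Q' → Alpha (par P Q) (par P' Q')

/-- Structural congruence: the smallest congruence containing α-equivalence and
making `(|, 0)` a commutative monoid. -/
inductive SC : Proc → Proc → Prop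
  | alpha {P Q : Proc} : Alpha P Q → SC P Q
  | parZero (P : Proc) : SC (par zero P) P
  | parComm (P Q : Proc) : SC (par P Q) (par Q P)
  | parAssoc (P Q R : Proc) : SC (par (par P Q) R) (par P (par Q R))
  | refl (P : Proc) : SC P P
  | symm {P Q : Proc} : SC P Q → SC Q P
  | trans {P Q R : Proc} : SC P Q → SC Q R → SC P R
  | input {P P' : Proc} (y x : Name) : SC P P' → SC (input y x P) (input y x P')
  | output {P P' : Proc} (x : Name) : SC P P' → SC (output x P) (output x P')
  | par {P P' Q Q' : Proc} : SC P P' → SC Q Q' → SC (par P Q) (par P' Q')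

/-- Name equivalence: the smallest equivalence relation with `&*x ≡ x` and
`&P ≡ &Q` whenever `P ≡ Q` (names being represented by the processes under the quote). -/
inductive NE : Name → Name → Prop
  | quoteDeref (x : Name) : NE (deref x) x
  | quote {P Q : Proc} : SC P Q → NE P Q
  | symm {x y : Name} : NE x y → NE y x
  | trans {x y z : Name} : NE x y → NE y z → NE x z

/-- Freshness condition on the renamed bound name in the substitution clause for input:
`z` is distinct from the substituted and substituting names `p` and `q`, from the
free names of (the process quoted by) `q`, and from all names in `R`. -/
def FreshFor (z p q : Name) (R : Proc) : Prop :=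
  z ≠ p ∧ z ≠ q ∧ z ∉ FN q ∧ z ∉ namesOf R

/-- Syntactic substitution: `SubS P q p P'` means `P{q/p} = P'`,
substituting the name `q` for the name `p`. -/
inductive SubS : Proc → Name → Name → Proc → Prop
  | zero (q p : Name) : SubS zero q p zero
  | inputHit {y x : Name} {R R₁ R₂ : Proc} {q p z : Name} :
      NE x p → FreshFor z p q R → SubS R z y R₁ → SubS R₁ q p R₂ →
      SubS (input y x R) q p (input z q R₂)
  | inputMiss {y x : Name} {R R₁ R₂ : Proc} {q p z : Name} :
      ¬ NE x p → FreshFor z p q R → SubS R z y R₁ → SubS R₁ q p R₂ →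
      SubS (input y x R) q p (input z x R₂)
  | outputHit {x : Name} {R R' : Proc} {q p : Name} :
      NE x p → SubS R q p R' → SubS (output x R) q p (output q R')
  | outputMiss {x : Name} {R R' : Proc} {q p : Name} :
      ¬ NE x p → SubS R q p R' → SubS (output x R) q p (output x R')
  | par {P P' Q Q' : Proc} {q p : Name} :
      SubS P q p P' → SubS Q q p Q' → SubS (par P Q) q p (par P' Q')
  | derefHit {x q p : Name} : NE x p → SubS (deref x) q p (deref q)
  | derefMiss {x q p : Name} : ¬ NE x p → SubS (deref x) q p (deref x)

/-- One-step reduction of the RHO calculus: communication, closed under parallel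
contexts and structural congruence.  In the communication rule the name `&Q` is
substituted for the bound name `y` (names being represented by quoted processes). -/
inductive Red : Proc → Proc → Prop
  | comm {x₀ x₁ y : Name} {P Q P' : Proc} :
      NE x₀ x₁ → SubS P Q y P' →
      Red (par (input y x₁ P) (output x₀ Q)) P'
  | par {P P' : Proc} (Q : Proc) : Red P P' → Red (par P Q) (par P' Q)
  | struct {P P' Q Q' : Proc} : SC P P' → Red P' Q' → SC Q' Q → Red P Q

/-- The observation relation `P ↓_𝒩 x` of the RHO calculus. -/
inductive Obs (𝒩 : Set Name) : Proc → Name → Prop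
  | out {x : Name} (P : Proc) : (∃ y ∈ 𝒩, NE x y) → Obs 𝒩 (output x P) x
  | parL {P : Proc} (Q : Proc) {x : Name} : Obs 𝒩 P x → Obs 𝒩 (par P Q) x
  | parR (P : Proc) {Q : Proc} {x : Name} : Obs 𝒩 Q x → Obs 𝒩 (par P Q) x

end Proc

/-- `𝒩`-barbed bisimilarity for an arbitrary reduction relation `red` and
observation relation `obs`. -/
def BarbedBisim {α : Type*} {ν : Type*} (red : α → α → Prop) (obs : α → ν → Prop)
    (P Q : α) : Prop :=
  ∃ S : α → α → Prop, Symmetric S ∧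
    (∀ a b, S a b →
      (∀ a', red a a' → ∃ b', Relation.ReflTransGen red b b' ∧ S a' b') ∧
      (∀ x, obs a x → ∃ b', Relation.ReflTransGen red b b' ∧ obs b' x)) ∧
    S P Q
/-- RHO combinators: constants `C, 0, |, for, !, &, *, S, K, I` and binary application. -/
inductive Comb : Type
  | C : Comb
  | zero : Comb
  | par : Comb
  | forC : Comb
  | bang : Comb
  | amp : Comb
  | star : Comb
  | S : Comb
  | K : Comb
  | I : Comb
  | app : Comb → Comb → Comb
deriving DecidableEq

namespace Comb

/-- A combinator is `C`-free when the constant `C` does not occur in it. -/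
def CFree : Comb → Prop
  | C => False
  | app a b => CFree a ∧ CFree b
  | _ => True

/-- Sorts for RHO combinators: the base sorts `W` (processes) and `N` (names), and arrow sorts. -/
inductive CSort : Type
  | W : CSort
  | N : CSort
  | arr : CSort → CSort → CSort
deriving DecidableEq

/-- The sorting discipline on RHO combinators. -/
inductive Sorted : Comb → CSort → Prop
  | C : Sorted C .W
  | zero : Sorted zero .W
  | par : Sorted par (.arr .W (.arr .W .W))
  | forC : Sorted forC (.arr .N (.arr (.arr .N .W) .W))
  | bang : Sorted bang (.arr .N (.arr .W .W))
  | amp : Sorted amp (.arr .W .N)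
  | star : Sorted star (.arr .N .W)
  | S (X Y Z : CSort) :
      Sorted S (.arr (.arr Z (.arr Y X)) (.arr (.arr Z Y) (.arr Z X)))
  | K (X Y : CSort) : Sorted K (.arr X (.arr Y X))
  | I (X : CSort) : Sorted I (.arr X X)
  | app {f a : Comb} {A B : CSort} :
      Sorted f (.arr A B) → Sorted a A → Sorted (app f a) B

/-- Structural congruence on RHO combinators: the smallest congruence making `(|, 0)`
a commutative monoid. -/
inductive SCc : Comb → Comb → Prop
  | parZero (P : Comb) : SCc (app (app par zero) P) P
  | parComm (P Q : Comb) : SCc (app (app par P) Q) (app (app par Q) P)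
  | parAssoc (P Q R : Comb) :
      SCc (app (app par (app (app par P) Q)) R) (app (app par P) (app (app par Q) R))
  | refl (P : Comb) : SCc P P
  | symm {P Q : Comb} : SCc P Q → SCc Q P
  | trans {P Q R : Comb} : SCc P Q → SCc Q R → SCc P R
  | app {a a' b b' : Comb} : SCc a a' → SCc b b' → SCc (app a b) (app a' b')

/-- The rewrites σ, κ, ι, closed under arbitrary term contexts. -/
inductive SKIStep : Comb → Comb → Prop
  | sigma (p q r : Comb) : SKIStep (app (app (app S p) q) r) (app (app p r) (app q r))
  | kappa (p q : Comb) : SKIStep (app (app K p) q) p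
  | iota (p : Comb) : SKIStep (app I p) p
  | appL {a a' : Comb} (b : Comb) : SKIStep a a' → SKIStep (app a b) (app a' b)
  | appR (a : Comb) {b b' : Comb} : SKIStep b b' → SKIStep (app a b) (app a b')

/-- One-step reduction of the RHO combinator calculus: σ, κ, ι closed under arbitrary
contexts, the top-level communication rewrite ξ and evaluation rewrite ε (with `C`-free
parameters), all closed under structural congruence. -/
inductive CStep : Comb → Comb → Prop
  | ski {a b : Comb} : SKIStep a b → CStep a b
  | xi {p q r : Comb} : CFree p → CFree q → CFree r →
      CStep (app (app par C)
               (app (app par (app (app forC (app amp p)) q)) (app (app bang (app amp p)) r)))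
            (app (app par C) (app q (app amp r)))
  | eps {p : Comb} : CFree p →
      CStep (app (app par C) (app star (app amp p))) (app (app par C) p)
  | struct {a a' b b' : Comb} : SCc a a' → CStep a' b' → SCc b' b → CStep a b

/-- One-step reduction of the RHO combinator calculus using only the rewrites
σ, κ, ι, ε (that is, without the communication rewrite ξ). -/
inductive CStepNoXi : Comb → Comb → Prop
  | ski {a b : Comb} : SKIStep a b → CStepNoXi a b
  | eps {p : Comb} : CFree p →
      CStepNoXi (app (app par C) (app star (app amp p))) (app (app par C) p)
  | struct {a a' b b' : Comb} : SCc a a' → CStepNoXi a' b' → SCc b' b → CStepNoXi a b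

end Comb
namespace Comb

/-- `occursIn v M` : the combinator `v` occurs as a subterm of `M`. -/
def occursIn (v : Comb) : Comb → Bool
  | app a b => v == app a b || occursIn v a || occursIn v b
  | m => v == m

/-- Abstraction elimination at the level of combinators (used for the nested
elimination `⟦⟦Q⟧_y⟧_x`): eliminate the "variable" `v` from a combinator. -/
def elimC (v : Comb) : Comb → Comb
  | app a b =>
      if ¬ occursIn v (app a b) then app K (app a b)
      else if app a b = v then I
      else app (app S (elimC v a)) (elimC v b)
  | m => if m = v then I else app K m

end Comb

open Classical in
mutual
/-- The interpretation `⟦-⟧` of RHO calculus processes as RHO combinators. -/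
noncomputable def interp : Proc → Comb
  | .zero => .zero
  | .input y x P => .app (.app .forC (.app .amp (interp x))) (elimAux (.app .amp (interp y)) y P)
  | .output x P => .app (.app .bang (.app .amp (interp x))) (interp P)
  | .par P Q => .app (.app .par (interp P)) (interp Q)
  | .deref x => .app .star (.app .amp (interp x))
termination_by P => (sizeOf P, 0)

/-- Abstraction elimination `⟦-⟧_v` of the free name `v` from a process:
`⟦P⟧_v = K ⟦P⟧` when `v` is not free in `P`, and otherwise the standard SKI
abstraction elimination following the structure of `P`.  The parameter `vc` is
the combinator `(& ⟦-⟧)` image of the name `v`, used for the nested elimination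
`⟦⟦Q⟧_y⟧_v` at the level of combinators. -/
noncomputable def elimAux (vc : Comb) (v : Name) (P : Proc) : Comb :=
  if ∀ w ∈ Proc.FN P, ¬ Proc.NE w v then .app .K (interp P)
  else
    match P with
    | .zero => .app .K .zero
    | .input y x Q =>
        .app (.app .S (.app (.app .S (.app .K .forC))
                (.app (.app .S (.app .K .amp)) (elimAux vc v x))))
          (Comb.elimC vc (elimAux (.app .amp (interp y)) y Q))
    | .output x Q =>
        .app (.app .S (.app (.app .S (.app .K .bang))
                (.app (.app .S (.app .K .amp)) (elimAux vc v x))))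
          (elimAux vc v Q)
    | .par Q₁ Q₂ =>
        .app (.app .S (.app (.app .S (.app .K .par)) (elimAux vc v Q₁))) (elimAux vc v Q₂)
    | .deref x =>
        if Proc.NE x v then .app (.app .S (.app .K .star)) .I
        else .app (.app .S (.app .K .star)) (.app (.app .S (.app .K .amp)) (elimAux vc v x))
termination_by (sizeOf P, 1)
end

/-- The combinator representing the name `v` (that is, `(& ⟦P⟧)` for `v = &P`). -/
noncomputable def nameComb (v : Name) : Comb := .app .amp (interp v)

/-- Abstraction elimination `⟦P⟧_v` of the free name `v` from the process `P`. -/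
noncomputable def elim (v : Name) (P : Proc) : Comb := elimAux (nameComb v) v P

/-- The reverse interpretation `⟪-⟫` from `C`-free `W`-sorted RHO combinators to RHO
calculus processes, as a relation (`Rev q P` means `⟪q⟫ = P`).  In the clause for input,
`r` ranges over arbitrary (`C`-free) `W`-sorted combinators. -/
inductive Rev : Comb → Proc → Prop
  | zero : Rev .zero .zero
  | par {p q : Comb} {P Q : Proc} :
      Rev p P → Rev q Q → Rev (.app (.app .par p) q) (.par P Q)
  | input {p q r : Comb} {P R QB : Proc} :
      Comb.Sorted r .W → Comb.CFree r → Rev r R → Rev p P →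
      Rev (.app q (.app .amp r)) QB →
      Rev (.app (.app .forC (.app .amp p)) q) (.input R P QB)
  | output {p q : Comb} {P Q : Proc} :
      Rev p P → Rev q Q → Rev (.app (.app .bang (.app .amp p)) q) (.output P Q)
  | deref {p : Comb} {P : Proc} : Rev p P → Rev (.app .star (.app .amp p)) (.deref P)
  | S {p q r : Comb} {X : Proc} :
      Rev (.app (.app p r) (.app q r)) X → Rev (.app (.app (.app .S p) q) r) X
  | K {p : Comb} (q : Comb) {X : Proc} : Rev p X → Rev (.app (.app .K p) q) X
  | I {p : Comb} {X : Proc} : Rev p X → Rev (.app .I p) X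

/-- Name equivalence at the level of RHO combinators: the smallest equivalence with
`(& (* x)) ≡ x` and `(& p) ≡ (& q)` whenever `p` and `q` are structurally congruent. -/
inductive NEc : Comb → Comb → Prop
  | quoteDeref (x : Comb) : NEc (.app .amp (.app .star x)) x
  | quote {p q : Comb} : Comb.SCc p q → NEc (.app .amp p) (.app .amp q)
  | refl (x : Comb) : NEc x x
  | symm {x y : Comb} : NEc x y → NEc y x
  | trans {x y z : Comb} : NEc x y → NEc y z → NEc x z

/-- The observation relation `↓_𝒩` on RHO combinators, observing a barb on the
combinator name `x` when `x` is name-equivalent to (the combinator image of) some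
name in `𝒩`. -/
inductive ObsC (𝒩 : Set Name) : Comb → Comb → Prop
  | out {x : Comb} (p : Comb) : (∃ y ∈ 𝒩, NEc x (nameComb y)) →
      ObsC 𝒩 (.app (.app .bang x) p) x
  | parL {p : Comb} (q : Comb) {x : Comb} : ObsC 𝒩 p x → ObsC 𝒩 (.app (.app .par p) q) x
  | parR (p : Comb) {q : Comb} {x : Comb} : ObsC 𝒩 q x → ObsC 𝒩 (.app (.app .par p) q) x

namespace TopCtx
open Comb

inductive V : Type
  | zero : V
  | par : V
  | pp : V → V
  | o : V
  | L : V
  | bad : V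
deriving DecidableEq

def free : V → Bool
  | .zero => true
  | .par => true
  | .pp x => free x
  | .o => true
  | .L => false
  | .bad => false

def m (x y : V) : V :=
  if x = .zero then y else if y = .zero then x
  else if free x = true ∧ free y = true then .o
  else if (x = .L ∧ free y = true) ∨ (free x = true ∧ y = .L) then .L
  else .bad

def vapp : V → V → V
  | .par, y => .pp y
  | .pp x, y => m x y
  | x, y => if free x = true ∧ free y = true then .o else .bad

def ev : Comb → V
  | .C => .L
  | .zero => .zero
  | .par => .par
  | .app a b => vapp (ev a) (ev b)
  | _ => .o

theorem free_m (x y : V) : free (m x y) = (free x && free y) := by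
  have h0 : free .zero = true := rfl
  have h1 : free .o = true := rfl
  have h2 : free .L = false := rfl
  have h3 : free .bad = false := rfl
  unfold m
  grind

theorem m_comm (x y : V) : m x y = m y x := by
  unfold m
  grind

theorem m_assoc (x y z : V) : m (m x y) z = m x (m y z) := by
  have h0 : free .zero = true := rfl
  have h1 : free .o = true := rfl
  have h2 : free .L = false := rfl
  have h3 : free .bad = false := rfl
  unfold m
  grind

theorem free_vapp (x y : V) : free (vapp x y) = (free x && free y) := by
  cases x <;> simp [vapp, free_m, free] <;> cases h : free y <;> simp [free]

theorem free_ev (t : Comb) : free (ev t) = true ↔ CFree t := by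
  induction t with
  | app a b iha ihb => simp [ev, free_vapp, CFree, iha, ihb]
  | _ => simp [ev, free, CFree]

theorem ev_SCc {a b : Comb} (h : SCc a b) : ev a = ev b := by
  induction h with
  | parZero P => simp [ev, vapp, m]
  | parComm P Q => simp [ev, vapp, m_comm (ev P) (ev Q)]
  | parAssoc P Q R => simp [ev, vapp, m_assoc]
  | refl => rfl
  | symm _ ih => exact ih.symm
  | trans _ _ i j => exact i.trans j
  | app _ _ i j => simp [ev, i, j]

inductive St : V → V → Prop
  | refl (x : V) : St x x
  | o (y : V) : free y = true → St .o y
  | bad (y : V) : St .bad y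
  | pp {x y : V} : St x y → St (.pp x) (.pp y)

theorem St.free {x y : V} (h : St x y) (hx : free x = true) : free y = true := by
  induction h with
  | refl => exact hx
  | o _ h => exact h
  | bad => simp [TopCtx.free] at hx
  | pp _ ih => exact ih hx

theorem St.of_L {y : V} (h : St .L y) : y = .L := by cases h; rfl
theorem St.of_zero {y : V} (h : St .zero y) : y = .zero := by cases h; rfl

theorem St.m {x x' y y' : V} (hx : St x x') (hy : St y y') : St (m x y) (m x' y') := by
  by_cases h1 : x = .zero
  · subst h1; rw [hx.of_zero]; simpa [TopCtx.m] using hy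
  by_cases h2 : y = .zero
  · subst h2; rw [hy.of_zero, m_comm, m_comm x']; simpa [TopCtx.m] using hx
  by_cases h3 : TopCtx.free x = true ∧ TopCtx.free y = true
  · have : TopCtx.m x y = .o := by simp [TopCtx.m, h1, h2, h3]
    rw [this]; apply St.o; rw [free_m, hx.free h3.1, hy.free h3.2]; rfl
  by_cases h4 : x = .L ∧ TopCtx.free y = true
  · obtain ⟨rfl, h⟩ := h4
    rw [hx.of_L]
    have := hy.free h
    have e : ∀ z, TopCtx.free z = true → TopCtx.m .L z = .L := by
      intro z hz; simp [TopCtx.m, hz, TopCtx.free]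
    rw [e _ h, e _ this]; exact .refl _
  by_cases h5 : TopCtx.free x = true ∧ y = .L
  · obtain ⟨h, rfl⟩ := h5
    rw [hy.of_L]
    have := hx.free h
    have e : ∀ z, TopCtx.free z = true → TopCtx.m z .L = .L := by
      intro z hz; simp [TopCtx.m, hz, TopCtx.free]
    rw [e _ h, e _ this]; exact .refl _
  have : TopCtx.m x y = .bad := by
    unfold TopCtx.m
    rw [if_neg h1, if_neg h2, if_neg h3, if_neg (by tauto)]
  rw [this]; exact .bad _

/-- a default application is always simulated when frees are preserved -/
theorem St.dflt {p : Prop} [Decidable p] {z : V} (h : p → TopCtx.free z = true) :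
    St (if p then .o else .bad) z := by
  split
  · exact .o _ (h ‹_›)
  · exact .bad _

theorem St.vapp {x x' y y' : V} (hx : St x x') (hy : St y y') :
    St (vapp x y) (vapp x' y') := by
  have key : (TopCtx.free x = true ∧ TopCtx.free y = true) →
      TopCtx.free (TopCtx.vapp x' y') = true := by
    rintro ⟨h1, h2⟩
    rw [free_vapp, hx.free h1, hy.free h2]; rfl
  cases x with
  | par => cases hx; exact .pp hy
  | pp u =>
    cases hx with
    | refl => exact St.m (.refl _) hy
    | pp h => exact St.m h hy
  | _ => exact St.dflt key

theorem vapp_o (y : V) : vapp .o y = if free y = true then .o else .bad := by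
  simp [vapp, free]

theorem vapp_bad (y : V) : vapp .bad y = .bad := by
  simp [vapp, free]

theorem ev_SKI {a b : Comb} (h : SKIStep a b) : St (ev a) (ev b) := by
  induction h with
  | sigma p q r =>
    simp only [ev, vapp_o]
    cases hp : free (ev p) <;> cases hq : free (ev q) <;> cases hr : free (ev r) <;>
      simp [vapp_o, vapp_bad, hp, hq, hr] <;>
      first
      | exact .bad _
      | exact .o _ (by simp [free_vapp, hp, hq, hr])
  | kappa p q =>
    simp only [ev, vapp_o]
    cases hp : free (ev p) <;> cases hq : free (ev q) <;>
      simp [vapp_o, vapp_bad, hp, hq] <;>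
      first
      | exact .bad _
      | exact .o _ hp
  | iota p =>
    simp only [ev, vapp_o]
    exact St.dflt id
  | appL b _ ih => exact St.vapp ih (.refl _)
  | appR a _ ih => exact St.vapp (.refl _) ih

theorem ev_top {t : Comb} (h : CFree t) : ev (.app (.app .par .C) t) = .L := by
  have := (free_ev t).2 h
  simp [ev, vapp, m, this, free]

theorem ev_step {a b : Comb} (h : CStep a b) (ha : ev a = .L) : ev b = .L := by
  induction h with
  | ski h => have := ev_SKI h; rw [ha] at this; exact this.of_L
  | xi hp hq hr => exact ev_top (by simp [CFree, *])
  | eps hp => exact ev_top hp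
  | struct h1 _ h2 ih => rw [← ev_SCc h2]; exact ih ((ev_SCc h1).symm.trans ha)

def R : V → Comb → Prop
  | .zero, t => SCc t .zero
  | .par, t => SCc t .par
  | .pp x, t => ∃ s, SCc t (.app .par s) ∧ R x s
  | .o, t => CFree t
  | .L, t => ∃ M, CFree M ∧ SCc t (.app (.app .par .C) M)
  | .bad, _ => True

theorem CFree_SCc {a b : Comb} (h : SCc a b) : CFree a ↔ CFree b := by
  rw [← free_ev, ← free_ev, ev_SCc h]

theorem R_SCc {v : V} {a b : Comb} (h : SCc a b) (hb : R v b) : R v a := by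
  cases v with
  | zero => exact h.trans hb
  | par => exact h.trans hb
  | pp x => obtain ⟨s, h1, h2⟩ := hb; exact ⟨s, h.trans h1, h2⟩
  | o => exact (CFree_SCc h).2 hb
  | L => obtain ⟨s, h1, h2⟩ := hb; exact ⟨s, h1, h.trans h2⟩
  | bad => trivial

theorem R_free {v : V} {a : Comb} (h : free v = true) (hb : R v a) : CFree a := by
  induction v generalizing a with
  | zero => exact (CFree_SCc hb).2 trivial
  | par => exact (CFree_SCc hb).2 trivial
  | pp x ih =>
    obtain ⟨s, h1, h2⟩ := hb
    exact (CFree_SCc h1).2 ⟨trivial, ih h h2⟩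
  | o => exact hb
  | L => simp [free] at h
  | bad => simp [free] at h

theorem R_m {x y : V} {s b : Comb} (hs : R x s) (hb : R y b) :
    R (m x y) (.app (.app .par s) b) := by
  unfold m
  split_ifs with h1 h2 h3 h4
  · subst h1
    exact R_SCc ((SCc.app (.app (.refl _) hs) (.refl _)).trans (.parZero _)) hb
  · subst h2
    exact R_SCc ((SCc.parComm _ _).trans
      ((SCc.app (.app (.refl _) hb) (.refl _)).trans (.parZero _))) hs
  · exact ⟨⟨trivial, R_free h3.1 hs⟩, R_free h3.2 hb⟩
  · rcases h4 with ⟨rfl, h⟩ | ⟨h, rfl⟩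
    · obtain ⟨M, hM, e⟩ := hs
      exact ⟨.app (.app .par M) b, ⟨⟨trivial, hM⟩, R_free h hb⟩,
        (SCc.app (.app (.refl _) e) (.refl _)).trans (.parAssoc _ _ _)⟩
    · obtain ⟨M, hM, e⟩ := hb
      exact ⟨.app (.app .par M) s, ⟨⟨trivial, hM⟩, R_free h hs⟩,
        (SCc.parComm _ _).trans
        ((SCc.app (.app (.refl _) e) (.refl _)).trans (.parAssoc _ _ _))⟩
  · trivial

theorem R_dflt {p : Prop} [Decidable p] {t : Comb} (h : p → CFree t) :
    R (if p then .o else .bad) t := by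
  split
  · exact h ‹_›
  · trivial

theorem R_app {x y : V} {a b : Comb} (ha : R x a) (hb : R y b) :
    R (vapp x y) (.app a b) := by
  have key : (free x = true ∧ free y = true) → CFree (.app a b) :=
    fun h => ⟨R_free h.1 ha, R_free h.2 hb⟩
  cases x with
  | par => exact ⟨b, .app ha (.refl _), hb⟩
  | pp u =>
    obtain ⟨s, h1, h2⟩ := ha
    exact R_SCc (.app h1 (.refl _)) (R_m h2 hb)
  | _ => exact R_dflt key

theorem R_ev (t : Comb) : R (ev t) t := by
  induction t with
  | app a b iha ihb => exact R_app iha ihb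
  | C =>
    exact ⟨.zero, trivial, (SCc.parZero _).symm.trans (.parComm _ _)⟩
  | zero => exact .refl _
  | par => exact .refl _
  | _ => trivial

end TopCtx

/-- the topmost context is the only reduction context for embedded
combinator terms: if `M` is `C`-free and `((| C) M)` reduces in one step to `T`,
then `T` is structurally congruent to `((| C) M')` for some `C`-free `M'`. -/
theorem stmt13 (M T : Comb) (hM : Comb.CFree M)
    (hstep : Comb.CStep (.app (.app .par .C) M) T) :
    ∃ M', Comb.CFree M' ∧ Comb.SCc T (.app (.app .par .C) M') := by
  have h := TopCtx.R_ev T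
  rw [TopCtx.ev_step hstep (TopCtx.ev_top hM)] at h
  exact h
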